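/- Every saturated convex Θ^3-drawing of a graph G on n ≥ 3 vertices has at least 7n/2 − 8 edges, i.e., 2·|E(G)| ≥ 7n − 16. -/

import Mathlib

/-- Points of the plane. -/
abbrev Pt : Type := ℝ × ℝ

/-- Two straight-line segments cross if some point lies in the interior
(open segment) of both. -/
def SegCross (a b c d : Pt) : Prop :=
  ∃ x : Pt, x ∈ openSegment ℝ a b ∧ x ∈ openSegment ℝ c d

/-- Two edges (unordered pairs of vertices) cross in the drawing `p`. -/
def EdgeCross {V : Type} (p : V → Pt) (e f : Sym2 V) : Prop :=
  ∃ u v x y : V, e = s(u, v) ∧ f = s(x, y) ∧ SegCross (p u) (p v) (p x) (p y)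

/-- The drawing `p` is injective and no three vertex points are collinear. -/
def GenPos {V : Type} (p : V → Pt) : Prop :=
  Function.Injective p ∧
    ∀ u v w : V, u ≠ v → u ≠ w → v ≠ w → ¬ Collinear ℝ ({p u, p v, p w} : Set Pt)

/-- The vertex points are in convex position: every vertex point is an extreme
point of the convex hull of all vertex points. -/
def ConvexPos {V : Type} (p : V → Pt) : Prop :=
  ∀ v : V, p v ∈ Set.extremePoints ℝ (convexHull ℝ (Set.range p))

/-- A `k`-coloring of the edges of `G` is crossing-free if no two distinct
edges of the same color cross. -/
def CrossingFree {V : Type} {k : ℕ} (G : SimpleGraph V) (p : V → Pt)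
    (φ : Sym2 V → Fin k) : Prop :=
  ∀ e ∈ G.edgeSet, ∀ f ∈ G.edgeSet, e ≠ f → φ e = φ f → ¬ EdgeCross p e f

open scoped Classical

/-- A precolored drawing `(G, p, φ)` is saturated: for every pair of distinct
non-adjacent vertices and every color `c`, assigning color `c` to the new edge
`uv` yields a coloring that is not crossing-free. -/
def PrecoloredSaturated {V : Type} {k : ℕ} (G : SimpleGraph V) (p : V → Pt)
    (φ : Sym2 V → Fin k) : Prop :=
  ∀ u v : V, u ≠ v → ¬ G.Adj u v → ∀ c : Fin k,
    ¬ CrossingFree (G ⊔ SimpleGraph.fromEdgeSet {s(u, v)}) p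
      (fun e => if e = s(u, v) then c else φ e)

/-- A (non-precolored) drawing of `G` is saturated for thickness `k`: for every
pair of distinct non-adjacent vertices `u, v`, the drawing of `G + uv` admits
no crossing-free `k`-coloring. -/
def Saturated {V : Type} (k : ℕ) (G : SimpleGraph V) (p : V → Pt) : Prop :=
  ∀ u v : V, u ≠ v → ¬ G.Adj u v →
    ∀ φ : Sym2 V → Fin k,
      ¬ CrossingFree (G ⊔ SimpleGraph.fromEdgeSet {s(u, v)}) p φ

/-- Twice the signed area of the triangle `a b c`. -/
def det2 (a b c : Pt) : ℝ :=
  (b.1 - a.1) * (c.2 - a.2) - (b.2 - a.2) * (c.1 - a.1)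

/-- An edge is an outer edge if its endpoints are consecutive on the boundary
of the convex hull of the vertex points, i.e. all other vertex points lie
strictly on one side of the line through its endpoints. -/
def IsOuterEdge {V : Type} (p : V → Pt) (e : Sym2 V) : Prop :=
  ∃ u v : V, e = s(u, v) ∧
    ((∀ w : V, w ≠ u → w ≠ v → 0 < det2 (p u) (p v) (p w)) ∨
     (∀ w : V, w ≠ u → w ≠ v → det2 (p u) (p v) (p w) < 0))


/-! Combinatorial part -/

def Cr (x y i j : ℕ) : Prop := (x < i ∧ i < y ∧ y < j) ∨ (i < x ∧ x < j ∧ j < y)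

def Comp (S : Finset (ℕ × ℕ)) (i j : ℕ) : Prop := ∀ x y, (x, y) ∈ S → ¬ Cr x y i j

theorem pick_aux (S : Finset (ℕ × ℕ)) (n : ℕ)
    (h1 : ∀ x, x + 1 < n → (x, x + 1) ∈ S)
    (hnc : ∀ x y, (x, y) ∈ S → Comp S x y) (i j : ℕ) (hij : i + 2 ≤ j) (hj : j < n)
    (hc : Comp S i j) :
    ∃ k, i < k ∧ k < j ∧ (i, k) ∈ S ∧ Comp S k j ∧
      ∀ l, k < l → l < j → (k, j) ∉ S → Comp S k l → Comp S l j → Comp S i l := by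
  have hne : ((Finset.range j).filter (fun k => i < k ∧ (i, k) ∈ S)).Nonempty :=
    ⟨i + 1, by simp only [Finset.mem_filter, Finset.mem_range]; exact ⟨by omega, by omega, h1 i (by omega)⟩⟩
  obtain ⟨k, hk, hmax⟩ := Finset.exists_max_image _ id hne
  simp only [Finset.mem_filter, Finset.mem_range, id] at hk hmax
  obtain ⟨hkj, hik, hikS⟩ := hk
  refine ⟨k, hik, hkj, hikS, ?_, ?_⟩
  · intro x y hxy hcr
    have e1 := hc x y hxy
    have e2 := hnc _ _ hikS x y hxy
    have e3 : x = i → y < j → y ≤ k := by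
      intro hx hy
      subst hx
      by_contra h
      have := hmax y ⟨hy, by omega, hxy⟩
      omega
    unfold Cr at *
    omega
  · intro l hkl hlj hkjS hckl hclj x y hxy hcr
    have e1 := hc x y hxy
    have e2 := hnc _ _ hikS x y hxy
    have e3 := hckl x y hxy
    have e4 := hclj x y hxy
    have e5 : ¬ (x = k ∧ y = j) := by rintro ⟨rfl, rfl⟩; exact hkjS hxy
    unfold Cr at *
    omega

def cnt (S : Finset (ℕ × ℕ)) (i j : ℕ) : ℕ := (S.filter (fun e => i ≤ e.1 ∧ e.2 ≤ j)).card

theorem cnt_super (S : Finset (ℕ × ℕ)) (hlt : ∀ x y, (x, y) ∈ S → x < y) (i k j : ℕ)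
    (hik : i < k) (hkj : k < j) : cnt S i k + cnt S k j ≤ cnt S i j := by
  unfold cnt
  rw [← Finset.card_union_of_disjoint]
  · apply Finset.card_le_card
    intro ⟨x, y⟩ h
    simp only [Finset.mem_union, Finset.mem_filter] at h ⊢
    rcases h with h | h
    · exact ⟨h.1, by omega, by omega⟩
    · exact ⟨h.1, by omega, by omega⟩
  · rw [Finset.disjoint_left]
    rintro ⟨x, y⟩ h h'
    simp only [Finset.mem_filter] at h h'
    have := hlt x y h.1
    omega

theorem cnt_split (S : Finset (ℕ × ℕ)) (hlt : ∀ x y, (x, y) ∈ S → x < y) (i k j : ℕ)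
    (hik : i < k) (hkj : k < j) (hS : (i, j) ∈ S) :
    1 + cnt S i k + cnt S k j ≤ cnt S i j := by
  have h := cnt_super (S.erase (i, j)) (fun x y h => hlt x y (Finset.mem_of_mem_erase h)) i k j hik hkj
  have e1 : cnt (S.erase (i, j)) i k = cnt S i k := by
    unfold cnt
    congr 1
    ext ⟨x, y⟩
    simp only [Finset.mem_filter, Finset.mem_erase, ne_eq, Prod.mk.injEq]
    constructor
    · tauto
    · rintro ⟨a, b, c⟩
      exact ⟨⟨by omega, a⟩, b, c⟩
  have e2 : cnt (S.erase (i, j)) k j = cnt S k j := by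
    unfold cnt
    congr 1
    ext ⟨x, y⟩
    simp only [Finset.mem_filter, Finset.mem_erase, ne_eq, Prod.mk.injEq]
    constructor
    · tauto
    · rintro ⟨a, b, c⟩
      exact ⟨⟨by omega, a⟩, b, c⟩
  have e3 : cnt (S.erase (i, j)) i j + 1 = cnt S i j := by
    unfold cnt
    rw [Finset.filter_erase]
    apply Finset.card_erase_add_one
    simp [hS]
  omega

theorem cnt_one (S : Finset (ℕ × ℕ)) (i j : ℕ) (hS : (i, j) ∈ S) : 1 ≤ cnt S i j := by
  unfold cnt
  apply Finset.card_pos.mpr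
  exact ⟨(i, j), by simp [hS]⟩

theorem cnt3 (S : Finset (ℕ × ℕ)) (n : ℕ)
    (hlt : ∀ x y, (x, y) ∈ S → x < y)
    (h1 : ∀ x, x + 1 < n → (x, x + 1) ∈ S)
    (hnc : ∀ x y, (x, y) ∈ S → Comp S x y)
    (hno : ∀ a b c d, a < b → b < c → c < d → d < n → Comp S a c → Comp S b d → False) :
    ∀ L i j, j = i + L → 1 ≤ L → j < n → (i, j) ∈ S → 2 * L ≤ cnt S i j + 1 := by
  intro L
  induction L using Nat.strong_induction_on with
  | _ L ih =>
    intro i j hj hL hjn hS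
    by_cases hL1 : L = 1
    · have := cnt_one S i j hS
      omega
    obtain ⟨k, hik, hkj, hikS, hckj, hk⟩ := pick_aux S n h1 hnc i j (by omega) hjn (hnc _ _ hS)
    by_cases hkS : (k, j) ∈ S
    · have a1 := ih (k - i) (by omega) i k (by omega) (by omega) (by omega) hikS
      have a2 := ih (j - k) (by omega) k j (by omega) (by omega) (by omega) hkS
      have a3 := cnt_split S hlt i k j hik hkj hS
      omega
    · exfalso
      have : k + 1 ≠ j := by
        rintro rfl
        exact hkS (h1 k hjn)
      obtain ⟨k', hkk', hk'j, hkk'S, hck'j, -⟩ := pick_aux S n h1 hnc k j (by omega) hjn hckj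
      exact hno i k k' j hik hkk' hk'j hjn (hk k' hkk' hk'j hkS (hnc _ _ hkk'S) hck'j) hckj

theorem cnt4 (S : Finset (ℕ × ℕ)) (n : ℕ)
    (hlt : ∀ x y, (x, y) ∈ S → x < y)
    (h1 : ∀ x, x + 1 < n → (x, x + 1) ∈ S)
    (hnc : ∀ x y, (x, y) ∈ S → Comp S x y)
    (hno : ∀ a b c d e, a < b → b < c → c < d → d < e → e < n → Comp S a c → Comp S b d →
      Comp S c e → Comp S a d → Comp S b e → False) :
    ∀ L i j, j = i + L → 1 ≤ L → j < n → (i, j) ∈ S → 3 * L ≤ 2 * cnt S i j + 1 := by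
  intro L
  induction L using Nat.strong_induction_on with
  | _ L ih =>
    intro i j hj hL hjn hS
    by_cases hL1 : L = 1
    · have := cnt_one S i j hS
      omega
    obtain ⟨k, hik, hkj, hikS, hckj, hk⟩ := pick_aux S n h1 hnc i j (by omega) hjn (hnc _ _ hS)
    have a1 := ih (k - i) (by omega) i k (by omega) (by omega) (by omega) hikS
    have a3 := cnt_split S hlt i k j hik hkj hS
    by_cases hkS : (k, j) ∈ S
    · have a2 := ih (j - k) (by omega) k j (by omega) (by omega) (by omega) hkS
      omega
    have : k + 1 ≠ j := by
      rintro rfl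
      exact hkS (h1 k hjn)
    obtain ⟨l, hkl, hlj, hklS, hclj, hl⟩ := pick_aux S n h1 hnc k j (by omega) hjn hckj
    by_cases hlS : (l, j) ∈ S
    · have a2 := ih (l - k) (by omega) k l (by omega) (by omega) (by omega) hklS
      have a4 := ih (j - l) (by omega) l j (by omega) (by omega) (by omega) hlS
      have a5 := cnt_super S hlt k l j hkl hlj
      omega
    exfalso
    have : l + 1 ≠ j := by
      rintro rfl
      exact hlS (h1 l hjn)
    obtain ⟨m, hlm, hmj, hlmS, hcmj, -⟩ := pick_aux S n h1 hnc l j (by omega) hjn hclj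
    have c1 := hk l hkl hlj hkS (hnc _ _ hklS) hclj
    have c2 := hl m hlm hmj hlS (hnc _ _ hlmS) hcmj
    have c3 := hk m (by omega) hmj hkS c2 hcmj
    exact hno i k l m j hik hkl hlm hmj hjn c1 c2 hclj c3 hckj

/-! Geometric part -/

theorem det2_ne {V : Type} (p : V → Pt) (hgen : GenPos p) (u v w : V)
    (h1 : u ≠ v) (h2 : u ≠ w) (h3 : v ≠ w) : det2 (p u) (p v) (p w) ≠ 0 := by
  intro h
  apply hgen.2 u v w h1 h2 h3
  have hne : p u ≠ p v := fun e => h1 (hgen.1 e)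
  rw [collinear_iff_of_mem (p₀ := p u) (by simp)]
  refine ⟨p v - p u, ?_⟩
  unfold det2 at h
  simp only [Set.mem_insert_iff, Set.mem_singleton_iff, forall_eq_or_imp, forall_eq]
  refine ⟨⟨0, by simp⟩, ⟨1, by simp⟩, ?_⟩
  by_cases hx : (p v).1 - (p u).1 = 0
  · have hy : (p v).2 - (p u).2 ≠ 0 := by
      intro hy
      exact hne (Prod.ext (by linarith) (by linarith))
    refine ⟨((p w).2 - (p u).2) / ((p v).2 - (p u).2), ?_⟩
    rw [hx] at h
    have : (p w).1 - (p u).1 = 0 := by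
      have : ((p v).2 - (p u).2) * ((p w).1 - (p u).1) = 0 := by linarith
      exact (mul_eq_zero.mp this).resolve_left hy
    ext
    · simp [hx]; linarith
    · simp; field_simp; ring
  · refine ⟨((p w).1 - (p u).1) / ((p v).1 - (p u).1), ?_⟩
    ext
    · simp; field_simp; ring
    · simp; field_simp; linarith

theorem no_inside {V : Type} (p : V → Pt) (hgen : GenPos p) (hconv : ConvexPos p) (q a b c : V)
    (hqa : q ≠ a)
    (h1 : 0 < det2 (p q) (p a) (p b)) (h2 : 0 < det2 (p q) (p b) (p c))
    (h3 : 0 < det2 (p q) (p c) (p a)) : False := by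
  set α := det2 (p q) (p a) (p b) with hα
  set β := det2 (p q) (p b) (p c) with hβ
  set γ := det2 (p q) (p c) (p a) with hγ
  have hq := hconv q
  have hmem : ∀ v, p v ∈ convexHull ℝ (Set.range p) := fun v => subset_convexHull ℝ _ ⟨v, rfl⟩
  have hx : (α / (α + γ)) • p c + (γ / (α + γ)) • p b ∈ convexHull ℝ (Set.range p) :=
    (convex_convexHull ℝ _) (hmem c) (hmem b) (by positivity) (by positivity) (by field_simp)
  have hs : p q ∈ openSegment ℝ (p a) ((α / (α + γ)) • p c + (γ / (α + γ)) • p b) := by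
    refine ⟨β / (α + β + γ), (α + γ) / (α + β + γ), by positivity, by positivity, by field_simp; ring, ?_⟩
    have e : α + β + γ ≠ 0 := by positivity
    have e' : α + γ ≠ 0 := by positivity
    ext
    · simp
      field_simp
      simp only [hα, hβ, hγ, det2]; ring
    · simp
      field_simp
      simp only [hα, hβ, hγ, det2]; ring
  have := (mem_extremePoints_iff_left.mp hq).2 _ (hmem a) _ hx hs
  exact hqa (hgen.1 this.symm)

theorem det2_rot (a b c : Pt) : det2 a b c = det2 b c a := by unfold det2; ring
theorem det2_swap (a b c : Pt) : det2 a b c = - det2 a c b := by unfold det2; ring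

theorem exists_label (n : ℕ) (hn : 3 ≤ n) (p : Fin n → Pt)
    (hgen : GenPos p) (hconv : ConvexPos p) :
    ∃ τ : Fin n ≃ Fin n, ∀ i j k : Fin n, i < j → j < k → 0 < det2 (p (τ i)) (p (τ j)) (p (τ k)) := by
  let z : Fin n := ⟨0, by omega⟩
  let r : Fin n → Fin n → Prop := fun a b => a ≠ b ∧ (a = z ∨ (b ≠ z ∧ 0 < det2 (p z) (p a) (p b)))
  have rtrans : ∀ a b c, r a b → r b c → r a c := by
    rintro a b c ⟨hab, h1⟩ ⟨hbc, h2⟩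
    rcases h1 with h1 | ⟨hb, h1⟩
    · have hc : c ≠ z := by
        rcases h2 with h2 | h2
        · exact absurd (h1.trans h2.symm) hab
        · exact h2.1
      exact ⟨fun e => hc (e ▸ h1), Or.inl h1⟩
    · rcases h2 with h2 | ⟨hc, h2⟩
      · exact absurd h2 hb
      · by_cases ha : a = z
        · exact ⟨fun e => hc (e ▸ ha), Or.inl ha⟩
        have hac : a ≠ c := by
          rintro rfl
          rw [det2_swap] at h2
          linarith
        refine ⟨hac, Or.inr ⟨hc, ?_⟩⟩
        by_contra hneg
        have hne := det2_ne p hgen z a c (Ne.symm ha) (Ne.symm hc) hac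
        have : 0 < det2 (p z) (p c) (p a) := by
          rw [det2_swap]
          have := lt_of_le_of_ne (not_lt.mp hneg) hne
          linarith
        exact no_inside p hgen hconv z a b c (Ne.symm ha) h1 h2 this
  have rtot : ∀ a b, a ≠ b → r a b ∨ r b a := by
    intro a b hab
    by_cases ha : a = z
    · exact Or.inl ⟨hab, Or.inl ha⟩
    by_cases hb : b = z
    · exact Or.inr ⟨hab.symm, Or.inl hb⟩
    have hne := det2_ne p hgen z a b (Ne.symm ha) (Ne.symm hb) hab
    rcases lt_or_gt_of_ne hne with h | h
    · right
      refine ⟨hab.symm, Or.inr ⟨ha, ?_⟩⟩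
      rw [det2_swap]; linarith
    · exact Or.inl ⟨hab, Or.inr ⟨hb, h⟩⟩
  have rirr : ∀ a, ¬ r a a := fun a h => h.1 rfl
  let lab : Fin n → Fin n := fun v => ⟨(Finset.univ.filter (fun u => r u v)).card, by
    have : (Finset.univ.filter (fun u => r u v)).card < (Finset.univ : Finset (Fin n)).card := by
      apply Finset.card_lt_card
      rw [Finset.filter_ssubset]
      exact ⟨v, Finset.mem_univ _, rirr v⟩
    simpa using this⟩
  have labmono : ∀ a b, r a b → lab a < lab b := by
    intro a b hab
    show (Finset.univ.filter (fun u => r u a)).card < (Finset.univ.filter (fun u => r u b)).card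
    apply Finset.card_lt_card
    rw [Finset.ssubset_iff_of_subset]
    · exact ⟨a, by simpa using hab, by simpa using rirr a⟩
    · intro x hx
      simp only [Finset.mem_filter, Finset.mem_univ, true_and] at hx ⊢
      exact rtrans _ _ _ hx hab
  have labr : ∀ a b, lab a < lab b → r a b := by
    intro a b h
    rcases eq_or_ne a b with rfl | hne
    · exact absurd h (lt_irrefl _)
    rcases rtot a b hne with h' | h'
    · exact h'
    · exact absurd (labmono _ _ h') (not_lt.mpr h.le)
  have labinj : Function.Injective lab := by
    intro a b h
    by_contra hne
    rcases rtot a b hne with h' | h'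
    · have := labmono _ _ h'
      rw [h] at this
      exact lt_irrefl _ this
    · have := labmono _ _ h'
      rw [h] at this
      exact lt_irrefl _ this
  let e : Fin n ≃ Fin n := Equiv.ofBijective lab (Finite.injective_iff_bijective.mp labinj)
  have he : ∀ i, lab (e.symm i) = i := fun i => e.apply_symm_apply i
  refine ⟨e.symm, ?_⟩
  intro i j k hij hjk
  have r1 : r (e.symm i) (e.symm j) := labr _ _ (by rw [he, he]; exact hij)
  have r2 : r (e.symm j) (e.symm k) := labr _ _ (by rw [he, he]; exact hjk)
  have r3 : r (e.symm i) (e.symm k) := labr _ _ (by rw [he, he]; exact hij.trans hjk)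
  generalize e.symm i = a at *
  generalize e.symm j = b at *
  generalize e.symm k = c at *
  have hbz : b ≠ z := by
    intro hb
    rcases r1.2 with h | h
    · exact r1.1 (h.trans hb.symm)
    · exact h.1 hb
  have d2 : 0 < det2 (p z) (p b) (p c) := (r2.2.resolve_left hbz).2
  by_cases ha : a = z
  · rw [ha]; exact d2
  have d1 := (r1.2.resolve_left ha).2
  by_contra hneg
  have hne := det2_ne p hgen a b c r1.1 r3.1 r2.1
  have hlt := lt_of_le_of_ne (not_lt.mp hneg) hne
  refine no_inside p hgen hconv b z a c hbz ?_ ?_ ?_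
  · rw [det2_rot]; exact d1
  · rw [← det2_rot, det2_swap, ← det2_rot] 
    rw [det2_rot, det2_swap, det2_rot, det2_rot] at hlt
    first
      | linarith
      | (unfold det2 at *; linarith)
  · rw [← det2_rot]; exact d2

theorem cross_of_det (a b c d : Pt) (h1 : 0 < det2 a b c) (h2 : 0 < det2 a b d)
    (h3 : 0 < det2 a c d) (h4 : 0 < det2 b c d) : SegCross a c b d := by
  have hs : det2 b c d + det2 a b d = det2 a c d + det2 a b c := by unfold det2; ring
  have e : det2 a c d + det2 a b c ≠ 0 := by positivity
  refine ⟨(det2 b c d / (det2 a c d + det2 a b c)) • a + (det2 a b d / (det2 a c d + det2 a b c)) • c,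
    ⟨_, _, by positivity, by positivity, ?_, rfl⟩,
    ⟨det2 a c d / (det2 a c d + det2 a b c), det2 a b c / (det2 a c d + det2 a b c),
      by positivity, by positivity, ?_, ?_⟩⟩
  · rw [← add_div, hs, div_self e]
  · rw [← add_div, div_self e]
  · ext
    · simp only [Prod.fst_add, Prod.smul_fst, smul_eq_mul]
      field_simp
      unfold det2; ring
    · simp only [Prod.snd_add, Prod.smul_snd, smul_eq_mul]
      field_simp
      unfold det2; ring

theorem det_of_cross (a b c d : Pt) (h : SegCross a b c d) :
    (0 < det2 a b c ∧ det2 a b d < 0) ∨ (det2 a b c < 0 ∧ 0 < det2 a b d) ∨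
      (det2 a b c = 0 ∧ det2 a b d = 0) := by
  obtain ⟨x, ⟨s, t, hs, ht, hst, rfl⟩, ⟨s', t', hs', ht', hst', hx⟩⟩ := h
  have e : s' * det2 a b c + t' * det2 a b d = 0 := by
    have h1 := congrArg Prod.fst hx
    have h2 := congrArg Prod.snd hx
    simp only [Prod.fst_add, Prod.smul_fst, smul_eq_mul, Prod.snd_add, Prod.smul_snd] at h1 h2
    have hs1 : s = 1 - t := by linarith
    have hs2 : s' = 1 - t' := by linarith
    subst hs1 hs2
    unfold det2
    linear_combination (b.1 - a.1) * h2 - (b.2 - a.2) * h1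
  rcases lt_trichotomy (det2 a b c) 0 with h | h | h
  · right; left
    refine ⟨h, ?_⟩
    by_contra hn
    nlinarith [mul_neg_of_pos_of_neg hs' h, mul_nonpos_of_nonneg_of_nonpos ht'.le (not_lt.mp hn)]
  · right; right
    rw [h] at e
    refine ⟨h, ?_⟩
    have : t' * det2 a b d = 0 := by linarith
    exact (mul_eq_zero.mp this).resolve_left ht'.ne'
  · left
    refine ⟨h, ?_⟩
    by_contra hn
    nlinarith [mul_pos hs' h, mul_nonneg ht'.le (not_lt.mp hn)]

theorem segCross_symm1 {a b c d : Pt} (h : SegCross a b c d) : SegCross b a c d := by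
  obtain ⟨x, h1, h2⟩ := h
  exact ⟨x, by rwa [openSegment_symm], h2⟩

theorem segCross_symm2 {a b c d : Pt} (h : SegCross a b c d) : SegCross a b d c := by
  obtain ⟨x, h1, h2⟩ := h
  exact ⟨x, h1, by rwa [openSegment_symm]⟩

theorem segCross_comm {a b c d : Pt} (h : SegCross a b c d) : SegCross c d a b := by
  obtain ⟨x, h1, h2⟩ := h
  exact ⟨x, h2, h1⟩

theorem edgeCross_iff {V : Type} (p : V → Pt) (a b c d : V) :
    EdgeCross p s(a, b) s(c, d) ↔ SegCross (p a) (p b) (p c) (p d) := by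
  constructor
  · rintro ⟨u, v, x, y, h1, h2, h⟩
    rw [Sym2.eq_iff] at h1 h2
    rcases h1 with ⟨rfl, rfl⟩ | ⟨rfl, rfl⟩ <;> rcases h2 with ⟨rfl, rfl⟩ | ⟨rfl, rfl⟩
    · exact h
    · exact segCross_symm2 h
    · exact segCross_symm1 h
    · exact segCross_symm1 (segCross_symm2 h)
  · intro h
    exact ⟨a, b, c, d, rfl, rfl, h⟩

theorem edgeCross_comm {V : Type} (p : V → Pt) (e f : Sym2 V) (h : EdgeCross p e f) :
    EdgeCross p f e := by
  obtain ⟨u, v, x, y, h1, h2, h⟩ := h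
  exact ⟨x, y, u, v, h2, h1, segCross_comm h⟩

/-- the combinatorial characterisation of crossings, ordered labels -/
theorem cross_iff_label (n : ℕ) (p : Fin n → Pt) (τ : Fin n ≃ Fin n)
    (hτ : ∀ i j k : Fin n, i < j → j < k → 0 < det2 (p (τ i)) (p (τ j)) (p (τ k)))
    (a b c d : Fin n) (hab : a < b) (hcd : c < d) (hne : ¬ (a = c ∧ b = d)) :
    EdgeCross p s(τ a, τ b) s(τ c, τ d) ↔ Cr a b c d := by
  rw [edgeCross_iff]
  have key : ∀ x : Fin n, (x < a ∧ 0 < det2 (p (τ a)) (p (τ b)) (p (τ x))) ∨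
      (x = a) ∨ (a < x ∧ x < b ∧ det2 (p (τ a)) (p (τ b)) (p (τ x)) < 0) ∨ x = b ∨
      (b < x ∧ 0 < det2 (p (τ a)) (p (τ b)) (p (τ x))) := by
    intro x
    rcases lt_trichotomy x a with h | h | h
    · left
      refine ⟨h, ?_⟩
      rw [← det2_rot]; exact hτ _ _ _ h hab
    · exact Or.inr (Or.inl h)
    rcases lt_trichotomy x b with h' | h' | h'
    · right; right; left
      refine ⟨h, h', ?_⟩
      rw [det2_swap]
      have := hτ _ _ _ h h'
      linarith
    · exact Or.inr (Or.inr (Or.inr (Or.inl h')))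
    · exact Or.inr (Or.inr (Or.inr (Or.inr ⟨h', hτ _ _ _ hab h'⟩)))
  constructor
  · intro h
    have hd := det_of_cross _ _ _ _ h
    have z1 : det2 (p (τ a)) (p (τ b)) (p (τ a)) = 0 := by unfold det2; ring
    have z2 : det2 (p (τ a)) (p (τ b)) (p (τ b)) = 0 := by unfold det2; ring
    have kc := key c
    have kd := key d
    have hne' : ¬ ((a : ℕ) = c ∧ (b : ℕ) = d) := fun h => hne ⟨Fin.ext h.1, Fin.ext h.2⟩
    rcases hd with ⟨h1, h2⟩ | ⟨h1, h2⟩ | ⟨h1, h2⟩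
    · have hc : c < a ∨ b < c := by
        rcases kc with k | k | k | k | k
        · exact Or.inl k.1
        · rw [k] at h1; linarith
        · linarith [k.2.2]
        · rw [k] at h1; linarith
        · exact Or.inr k.1
      have hd : a < d ∧ d < b := by
        rcases kd with k | k | k | k | k
        · linarith [k.2]
        · rw [k] at h2; linarith
        · exact ⟨k.1, k.2.1⟩
        · rw [k] at h2; linarith
        · linarith [k.2]
      simp only [Fin.lt_def] at *
      unfold Cr
      omega
    · have hc : d < a ∨ b < d := by
        rcases kd with k | k | k | k | k
        · exact Or.inl k.1
        · rw [k] at h2; linarith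
        · linarith [k.2.2]
        · rw [k] at h2; linarith
        · exact Or.inr k.1
      have hd : a < c ∧ c < b := by
        rcases kc with k | k | k | k | k
        · linarith [k.2]
        · rw [k] at h1; linarith
        · exact ⟨k.1, k.2.1⟩
        · rw [k] at h1; linarith
        · linarith [k.2]
      simp only [Fin.lt_def] at *
      unfold Cr
      omega
    · exfalso
      have hc : c = a ∨ c = b := by
        rcases kc with k | k | k | k | k
        · linarith [k.2]
        · exact Or.inl k
        · linarith [k.2.2]
        · exact Or.inr k
        · linarith [k.2]
      have hd : d = a ∨ d = b := by
        rcases kd with k | k | k | k | k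
        · linarith [k.2]
        · exact Or.inl k
        · linarith [k.2.2]
        · exact Or.inr k
        · linarith [k.2]
      simp only [Fin.lt_def, Fin.ext_iff] at *
      omega
  · rintro (⟨h1, h2, h3⟩ | ⟨h1, h2, h3⟩)
    · have h1 : a < c := h1
      have h2 : c < b := h2
      have h3 : b < d := h3
      exact cross_of_det _ _ _ _ (hτ _ _ _ h1 h2) (hτ _ _ _ h1 hcd) (hτ _ _ _ hab h3) (hτ _ _ _ h2 h3)
    · have h1 : c < a := h1
      have h2 : a < d := h2
      have h3 : d < b := h3
      exact segCross_comm (cross_of_det _ _ _ _ (hτ _ _ _ h1 h2) (hτ _ _ _ h1 hab)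
        (hτ _ _ _ hcd h3) (hτ _ _ _ h2 h3))

/-- choose a coloring minimizing the sum of the colors -/
theorem exists_good {V : Type} [Fintype V] (G : SimpleGraph V) (p : V → Pt)
    (hθ : ∃ φ : Sym2 V → Fin 3, CrossingFree G p φ) (hsat : Saturated 3 G p) :
    ∃ φ : Sym2 V → Fin 3, CrossingFree G p φ ∧ ∀ u v : V, u ≠ v → ∀ c : Fin 3,
      (∀ e ∈ G.edgeSet, e ≠ s(u, v) → φ e = c → ¬ EdgeCross p e s(u, v)) →
      G.Adj u v ∧ φ s(u, v) ≤ c := by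
  obtain ⟨φ, hφ, hmin⟩ := Set.exists_min_image {φ : Sym2 V → Fin 3 | CrossingFree G p φ}
    (fun φ => ∑ e ∈ G.edgeFinset, (φ e : ℕ)) (Set.toFinite _) hθ
  refine ⟨φ, hφ, ?_⟩
  intro u v huv c hc
  have gen : ∀ H : SimpleGraph V, (∀ e ∈ H.edgeSet, e ≠ s(u, v) → e ∈ G.edgeSet) →
      CrossingFree H p (Function.update φ s(u, v) c) := by
    intro H hH e he f hf hef hcol
    by_cases h1 : e = s(u, v)
    · have h2 : f ≠ s(u, v) := fun h => hef (h1.trans h.symm)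
      rw [h1, Function.update_self, Function.update_of_ne h2] at hcol
      intro hx
      rw [h1] at hx
      exact hc f (hH f hf h2) h2 hcol.symm (edgeCross_comm _ _ _ hx)
    · by_cases h2 : f = s(u, v)
      · rw [h2, Function.update_self, Function.update_of_ne h1] at hcol
        rw [h2]
        exact hc e (hH e he h1) h1 hcol
      · rw [Function.update_of_ne h1, Function.update_of_ne h2] at hcol
        exact hφ e (hH e he h1) f (hH f hf h2) hef hcol
  by_cases hadj : G.Adj u v
  · refine ⟨hadj, ?_⟩
    by_contra hlt
    have hlt := not_le.mp hlt
    have := hmin _ (gen G (fun e he _ => he))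
    have h2 : ∑ e ∈ G.edgeFinset, (Function.update φ s(u, v) c e : ℕ) <
        ∑ e ∈ G.edgeFinset, (φ e : ℕ) := by
      apply Finset.sum_lt_sum
      · intro e _
        by_cases h : e = s(u, v)
        · rw [h, Function.update_self]; exact hlt.le
        · rw [Function.update_of_ne h]
      · exact ⟨s(u, v), by simpa using hadj, by rw [Function.update_self]; exact hlt⟩
    exact absurd this (not_le.mpr h2)
  · exfalso
    refine hsat u v huv hadj _ (gen _ ?_)
    intro e he hne
    rw [SimpleGraph.edgeSet_sup] at he
    rcases he with he | he
    · exact he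
    · rw [SimpleGraph.edgeSet_fromEdgeSet] at he
      exact absurd he.1 hne

/-- Every saturated convex Θ^3-drawing of a graph on `n ≥ 3`
vertices has at least `7n/2 - 8` edges. -/
theorem stmt9 (n : ℕ) (hn : 3 ≤ n)
    (G : SimpleGraph (Fin n)) (p : Fin n → Pt)
    (hgen : GenPos p) (hconv : ConvexPos p)
    (hθ : ∃ φ : Sym2 (Fin n) → Fin 3, CrossingFree G p φ)
    (hsat : Saturated 3 G p) :
    2 * (G.edgeSet.ncard : ℤ) ≥ 7 * (n : ℤ) - 16 := by
  obtain ⟨φ, hφ, hP⟩ := exists_good G p hθ hsat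
  obtain ⟨τ, hτ⟩ := exists_label n hn p hgen hconv
  have hX := cross_iff_label n p τ hτ
  let v : ℕ → Fin n := fun x => if h : x < n then τ ⟨x, h⟩ else τ ⟨0, by omega⟩
  have hv : ∀ x : Fin n, v x = τ x := by
    intro x
    simp [v]
  have hv' : ∀ x (h : x < n), v x = τ ⟨x, h⟩ := by
    intro x h
    simp [v, h]
  let A : Finset (ℕ × ℕ) := (Finset.range n ×ˢ Finset.range n).filter (fun e => e.1 < e.2)
  have hA : ∀ x y, (x, y) ∈ A ↔ x < y ∧ y < n := by
    intro x y
    simp only [A, Finset.mem_filter, Finset.mem_product, Finset.mem_range]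
    omega
  let O : Finset (ℕ × ℕ) := A.filter (fun e => e.2 = e.1 + 1 ∨ (e.1 = 0 ∧ e.2 = n - 1))
  let E : Finset (ℕ × ℕ) := A.filter (fun e => G.Adj (v e.1) (v e.2))
  let S : Fin 3 → Finset (ℕ × ℕ) := fun c => A.filter (fun e =>
    (e.2 = e.1 + 1 ∨ (e.1 = 0 ∧ e.2 = n - 1)) ∨ (G.Adj (v e.1) (v e.2) ∧ φ s(v e.1, v e.2) = c))
  have hS : ∀ c x y, (x, y) ∈ S c ↔ (x < y ∧ y < n) ∧ ((y = x + 1 ∨ (x = 0 ∧ y = n - 1)) ∨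
      (G.Adj (v x) (v y) ∧ φ s(v x, v y) = c)) := by
    intro c x y
    simp only [S, Finset.mem_filter, hA]
  have hXN : ∀ a b c d, a < b → b < n → c < d → d < n → ¬ (a = c ∧ b = d) →
      (EdgeCross p s(v a, v b) s(v c, v d) ↔ Cr a b c d) := by
    intro a b c d hab hb hcd hd hne
    rw [hv' a (by omega), hv' b hb, hv' c (by omega), hv' d hd]
    exact hX _ _ _ _ hab hcd (by simpa [Fin.ext_iff] using hne)
  have vinj : ∀ a b, a < n → b < n → v a = v b → a = b := by
    intro a b ha hb h
    rw [hv' a ha, hv' b hb] at h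
    simpa using h
  have sinj : ∀ a b c d, a < b → b < n → c < d → d < n → s(v a, v b) = s(v c, v d) →
      a = c ∧ b = d := by
    intro a b c d hab hb hcd hd h
    rw [Sym2.eq_iff] at h
    rcases h with ⟨h1, h2⟩ | ⟨h1, h2⟩
    · exact ⟨vinj _ _ (by omega) (by omega) h1, vinj _ _ (by omega) (by omega) h2⟩
    · have := vinj _ _ (by omega) (by omega) h1
      have := vinj _ _ (by omega) (by omega) h2
      omega
  have key : ∀ c i j, i < j → j < n → Comp (S c) i j → G.Adj (v i) (v j) ∧ φ s(v i, v j) ≤ c := by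
    intro c i j hij hj hcomp
    apply hP _ _ (fun h => by have := vinj _ _ (by omega) hj h; omega) c
    intro e he hne hcol
    induction e using Sym2.ind with
    | _ a b =>
    have main : ∀ x y, x < y → y < n → s(a, b) = s(v x, v y) →
        ¬ EdgeCross p s(a, b) s(v i, v j) := by
      intro x y hxy hy h hcr
      rw [h] at hcr hne hcol he
      rw [hXN x y i j hxy hy hij hj (by rintro ⟨rfl, rfl⟩; exact hne rfl)] at hcr
      exact hcomp x y ((hS _ _ _).mpr ⟨⟨hxy, hy⟩, Or.inr ⟨he, hcol⟩⟩) hcr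
    obtain ⟨x, rfl⟩ := τ.surjective a
    obtain ⟨y, rfl⟩ := τ.surjective b
    have hxy : x ≠ y := by
      rintro rfl
      exact G.loopless.irrefl _ he
    rcases lt_or_gt_of_ne hxy with h | h
    · exact main x y h y.2 (by rw [hv, hv])
    · exact main y x h x.2 (by rw [hv, hv, Sym2.eq_swap])
  have hadj_cross : ∀ a b c d, a < b → b < c → c < d → d < n → G.Adj (v a) (v c) →
      G.Adj (v b) (v d) → φ s(v a, v c) ≠ φ s(v b, v d) := by
    intro a b c d hab hbc hcd hd h1 h2 heq
    refine hφ _ h1 _ h2 ?_ heq ?_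
    · intro h
      have := sinj _ _ _ _ (by omega) (by omega) (by omega) (by omega) h
      omega
    · rw [hXN _ _ _ _ (by omega) (by omega) (by omega) (by omega) (by omega)]
      unfold Cr; omega
  have hlt : ∀ c x y, (x, y) ∈ S c → x < y := fun c x y h => ((hS _ _ _).mp h).1.1
  have h1 : ∀ c x, x + 1 < n → (x, x + 1) ∈ S c := fun c x h =>
    (hS _ _ _).mpr ⟨⟨by omega, h⟩, Or.inl (Or.inl rfl)⟩
  have h0 : ∀ c, (0, n - 1) ∈ S c := fun c =>
    (hS _ _ _).mpr ⟨⟨by omega, by omega⟩, Or.inl (Or.inr ⟨rfl, rfl⟩)⟩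
  have hout : ∀ c x y, x < y → y < n → (y = x + 1 ∨ (x = 0 ∧ y = n - 1)) → Comp (S c) x y := by
    intro c x y hxy hy ho x' y' h' hcr
    have := ((hS _ _ _).mp h').1
    unfold Cr at hcr
    omega
  have hnc : ∀ c x y, (x, y) ∈ S c → Comp (S c) x y := by
    intro c x y h
    obtain ⟨⟨hxy, hy⟩, h⟩ := (hS _ _ _).mp h
    rcases h with h | ⟨hadj, hcol⟩
    · exact hout c x y hxy hy h
    intro x' y' h' hcr
    obtain ⟨⟨hxy', hy'⟩, h'⟩ := (hS _ _ _).mp h'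
    rcases h' with h' | ⟨hadj', hcol'⟩
    · unfold Cr at hcr; omega
    have hne : ¬ (x' = x ∧ y' = y) := by unfold Cr at hcr; omega
    refine hφ _ hadj' _ hadj (fun h => hne (sinj _ _ _ _ hxy' hy' hxy hy h)) (hcol'.trans hcol.symm) ?_
    rw [hXN _ _ _ _ hxy' hy' hxy hy hne]
    exact hcr
  have four : ∀ c a b d e, a < b → b < d → d < e → e < n → Comp (S c) a d → Comp (S c) b e →
      (G.Adj (v a) (v d) ∧ φ s(v a, v d) < c) ∧ (G.Adj (v b) (v e) ∧ φ s(v b, v e) < c) ∧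
      φ s(v a, v d) ≠ φ s(v b, v e) := by
    intro c a b d e hab hbd hde he hc1 hc2
    have k1 := key c a d (by omega) (by omega) hc1
    have k2 := key c b e (by omega) (by omega) hc2
    refine ⟨⟨k1.1, lt_of_le_of_ne k1.2 ?_⟩, ⟨k2.1, lt_of_le_of_ne k2.2 ?_⟩,
      hadj_cross a b d e hab hbd hde he k1.1 k2.1⟩
    · intro h
      exact hc2 a d ((hS _ _ _).mpr ⟨⟨by omega, by omega⟩, Or.inr ⟨k1.1, h⟩⟩) (by unfold Cr; omega)
    · intro h
      exact hc1 b e ((hS _ _ _).mpr ⟨⟨by omega, by omega⟩, Or.inr ⟨k2.1, h⟩⟩) (by unfold Cr; omega)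
  have no4 : ∀ c : Fin 3, c ≤ 1 → ∀ a b d e, a < b → b < d → d < e → e < n → Comp (S c) a d →
      Comp (S c) b e → False := by
    intro c hc a b d e hab hbd hde he hc1 hc2
    obtain ⟨⟨_, q1⟩, ⟨_, q2⟩, q3⟩ := four c a b d e hab hbd hde he hc1 hc2
    generalize φ s(v a, v d) = y at *
    generalize φ s(v b, v e) = z at *
    omega
  have cntle : ∀ c, cnt (S c) 0 (n - 1) ≤ (S c).card := fun c =>
    Finset.card_le_card (Finset.filter_subset _ _)
  have c0 := cnt3 (S 0) n (hlt 0) (h1 0) (hnc 0) (no4 0 (by decide)) (n - 1) 0 (n - 1) (by omega)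
    (by omega) (by omega) (h0 0)
  have c1 := cnt3 (S 1) n (hlt 1) (h1 1) (hnc 1) (no4 1 (by decide)) (n - 1) 0 (n - 1) (by omega)
    (by omega) (by omega) (h0 1)
  have c2 := cnt4 (S 2) n (hlt 2) (h1 2) (hnc 2) (by
    intro a b c d e hab hbc hcd hde he k1 k2 k3 k4 k5
    obtain ⟨⟨_, q1⟩, ⟨_, q2⟩, q3⟩ := four 2 a b c d hab hbc hcd (by omega) k1 k2
    obtain ⟨_, ⟨_, r2⟩, r3⟩ := four 2 b c d e hbc hcd hde (by omega) k2 k3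
    obtain ⟨⟨_, s1⟩, _, s3⟩ := four 2 a c d e (by omega) hcd hde (by omega) k4 k3
    obtain ⟨_, ⟨_, t2⟩, t3⟩ := four 2 a b d e (by omega) (by omega) hde (by omega) k4 k5
    obtain ⟨_, _, u3⟩ := four 2 a b c e (by omega) (by omega) (by omega) (by omega) k1 k5
    generalize φ s(v a, v c) = x1 at *
    generalize φ s(v b, v d) = x2 at *
    generalize φ s(v c, v e) = x3 at *
    generalize φ s(v a, v d) = x4 at *
    generalize φ s(v b, v e) = x5 at *
    omega) (n - 1) 0 (n - 1) (by omega)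
    (by omega) (by omega) (h0 2)
  have hO : O.card = n := by
    have : O = (Finset.range (n - 1)).image (fun x => (x, x + 1)) ∪ {(0, n - 1)} := by
      ext ⟨x, y⟩
      simp only [O, Finset.mem_filter, hA, Finset.mem_union, Finset.mem_image, Finset.mem_range,
        Finset.mem_singleton, Prod.mk.injEq]
      constructor
      · rintro ⟨h, h' | h'⟩
        · exact Or.inl ⟨x, by omega, rfl, h'.symm⟩
        · exact Or.inr h'
      · rintro (⟨a, h, rfl, rfl⟩ | h)
        · omega
        · omega
    rw [this, Finset.card_union_of_disjoint, Finset.card_image_of_injective, Finset.card_range,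
      Finset.card_singleton]
    · omega
    · intro a b h
      simpa using h
    · rw [Finset.disjoint_singleton_right]
      simp only [Finset.mem_image, Finset.mem_range, Prod.mk.injEq, not_exists, not_and]
      intros
      omega
  have hOE : O ⊆ E := by
    rintro ⟨x, y⟩ h
    simp only [O, E, Finset.mem_filter, hA] at h ⊢
    exact ⟨h.1, (key 0 x y h.1.1 h.1.2 (hout 0 x y h.1.1 h.1.2 h.2)).1⟩
  have hED : (E \ O).card + n = E.card := by
    rw [← hO]
    exact Finset.card_sdiff_add_card_eq_card hOE
  have hfib : (E \ O).card = ∑ c : Fin 3, ((E \ O).filter (fun e => φ s(v e.1, v e.2) = c)).card :=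
    Finset.card_eq_sum_card_fiberwise (fun _ _ => Finset.mem_coe.mpr (Finset.mem_univ _))
  have hSc : ∀ c, (S c).card ≤ n + ((E \ O).filter (fun e => φ s(v e.1, v e.2) = c)).card := by
    intro c
    have hO' : ∀ m, (S c).card ≤ O.card + m → (S c).card ≤ n + m := fun m h => by omega
    apply hO'
    refine le_trans (Finset.card_le_card ?_) (Finset.card_union_le _ _)
    rintro ⟨x, y⟩ h
    simp only [S, O, E, Finset.mem_union, Finset.mem_sdiff, Finset.mem_filter] at h ⊢
    tauto
  have hE : E.card ≤ G.edgeSet.ncard := by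
    rw [← Set.ncard_coe_finset E]
    apply Set.ncard_le_ncard_of_injOn (fun e => s(v e.1, v e.2))
    · rintro ⟨x, y⟩ h
      simp only [E, Finset.coe_filter, Set.mem_ofPred_eq] at h
      exact h.2
    · rintro ⟨x, y⟩ h ⟨x', y'⟩ h' heq
      simp only [E, Finset.coe_filter, Set.mem_ofPred_eq, hA] at h h'
      have := sinj _ _ _ _ h.1.1 h.1.2 h'.1.1 h'.1.2 heq
      exact Prod.ext this.1 this.2
  rw [Fin.sum_univ_three] at hfib
  have := hSc 0
  have := hSc 1
  have := hSc 2
  have := cntle 0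
  have := cntle 1
  have := cntle 2
  omega
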